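/- Suppose the step set S satisfies S = -S with symmetric weights ω_s = ω_{-s}, and a = max S. Then the excursion generating function E is algebraic over K(t) of degree at most 2^a. -/

import Mathlib

open scoped Classical

/-- Partial sum of the first `m` steps of a walk `f : Fin n → ℤ`. -/
def psum {n : ℕ} (f : Fin n → ℤ) (m : ℕ) : ℤ :=
  ∑ i ∈ Finset.univ.filter (fun i : Fin n => (i : ℕ) < m), f i

/-- The weighted length generating function of excursions with steps in `S`:
walks with non-negative partial sums ending at level `0`, each step `s`
carrying weight `ω s`. -/
noncomputable def excursionGFW {K : Type*} [Field K] (S : Finset ℤ) (ω : ℤ → K) :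
    PowerSeries K :=
  PowerSeries.mk fun n =>
    ∑ f ∈ ((Fintype.piFinset fun _ : Fin n => S).filter fun f =>
        (∀ m : ℕ, 0 ≤ psum f m) ∧ psum f n = 0), ∏ i, ω (f i)

lemma psum_snoc_le {n : ℕ} (f : Fin n → ℤ) (s : ℤ) (m : ℕ) (hm : m ≤ n) :
    psum (Fin.snoc f s : Fin (n+1) → ℤ) m = psum f m := by
  unfold psum
  rw [Finset.sum_filter, Finset.sum_filter, Fin.sum_univ_castSucc]
  simp only [Fin.snoc_castSucc, Fin.snoc_last, Fin.val_castSucc, Fin.val_last]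
  rw [if_neg (by omega), add_zero]

lemma psum_ge {n : ℕ} (f : Fin n → ℤ) (m : ℕ) (hm : n ≤ m) : psum f m = ∑ i, f i := by
  unfold psum
  rw [Finset.filter_true_of_mem]
  intro i _
  exact lt_of_lt_of_le i.2 hm

lemma psum_snoc_gt {n : ℕ} (f : Fin n → ℤ) (s : ℤ) (m : ℕ) (hm : n < m) :
    psum (Fin.snoc f s : Fin (n+1) → ℤ) m = psum f n + s := by
  rw [psum_ge _ _ hm, psum_ge _ _ le_rfl, Fin.sum_univ_castSucc]
  simp

lemma walk_cond {n : ℕ} (f : Fin n → ℤ) (s k : ℤ) (hk : 0 ≤ k) :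
    ((∀ m : ℕ, 0 ≤ psum (Fin.snoc f s : Fin (n+1) → ℤ) m) ∧
      psum (Fin.snoc f s : Fin (n+1) → ℤ) (n+1) = k) ↔
    ((∀ m : ℕ, 0 ≤ psum f m) ∧ psum f n = k - s) := by
  rw [psum_snoc_gt f s (n+1) (by omega)]
  constructor
  · rintro ⟨h1, h2⟩
    refine ⟨fun m => ?_, by omega⟩
    rcases le_total m n with hm | hm
    · have := h1 m
      rwa [psum_snoc_le f s m hm] at this
    · rw [psum_ge f m hm, ← psum_ge f n le_rfl]
      have := h1 n
      rwa [psum_snoc_le f s n le_rfl] at this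
  · rintro ⟨h1, h2⟩
    refine ⟨fun m => ?_, by omega⟩
    rcases Nat.lt_or_ge n m with hm | hm
    · rw [psum_snoc_gt f s m hm]; omega
    · rw [psum_snoc_le f s m hm]; exact h1 m

/-- Weighted number of nonnegative walks of length `n` ending at `k`. -/
noncomputable def walkW {K : Type*} [Field K] (S : Finset ℤ) (ω : ℤ → K) (n : ℕ) (k : ℤ) : K :=
  ∑ f ∈ ((Fintype.piFinset fun _ : Fin n => S).filter fun f =>
        (∀ m : ℕ, 0 ≤ psum f m) ∧ psum f n = k), ∏ i, ω (f i)

lemma walkW_zero {K : Type*} [Field K] (S : Finset ℤ) (ω : ℤ → K) (k : ℤ) :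
    walkW S ω 0 k = if k = 0 then 1 else 0 := by
  unfold walkW
  rw [Finset.sum_filter]
  have h : ∀ (f : Fin 0 → ℤ) m, psum f m = 0 := fun f m => by simp [psum]
  simp only [h, le_refl, implies_true, true_and, eq_comm (a := (0:ℤ))]
  simp

lemma walkW_neg {K : Type*} [Field K] (S : Finset ℤ) (ω : ℤ → K) (n : ℕ) (k : ℤ) (hk : k < 0) :
    walkW S ω n k = 0 := by
  unfold walkW
  rw [Finset.filter_false_of_mem, Finset.sum_empty]
  rintro f - ⟨h1, h2⟩
  have := h1 n
  omega

lemma walkW_succ {K : Type*} [Field K] (S : Finset ℤ) (ω : ℤ → K) (n : ℕ) (k : ℤ) (hk : 0 ≤ k) :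
    walkW S ω (n+1) k = ∑ s ∈ S, ω s * walkW S ω n (k - s) := by
  unfold walkW
  simp only [Finset.sum_filter, Finset.mul_sum]
  rw [← Finset.sum_product']
  refine Finset.sum_nbij' (fun f => (f (Fin.last n), Fin.init f))
    (fun p => (Fin.snoc p.2 p.1 : Fin (n+1) → ℤ)) ?_ ?_ ?_ ?_ ?_
  · intro f hf
    simp only [Fintype.mem_piFinset, Finset.mem_product] at hf ⊢
    exact ⟨hf _, fun i => hf _⟩
  · intro p hp
    simp only [Fintype.mem_piFinset, Finset.mem_product] at hp ⊢
    intro i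
    refine Fin.lastCases ?_ (fun i => ?_) i
    · simpa using hp.1
    · simpa using hp.2 i
  · intro f _
    exact Fin.snoc_init_self f
  · intro p _
    simp
  · intro f _
    obtain ⟨g, s, rfl⟩ : ∃ (g : Fin n → ℤ) (s : ℤ), f = (Fin.snoc g s : Fin (n+1) → ℤ) :=
      ⟨Fin.init f, f (Fin.last n), (Fin.snoc_init_self f).symm⟩
    simp only [Fin.snoc_last, Fin.init_snoc, walk_cond g s k hk]
    split_ifs
    · rw [Fin.prod_univ_castSucc]
      simp [mul_comm]
    · simp

open LaurentPolynomial in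
lemma trunc_coeff' {K : Type*} [Field K] (p : K[T;T⁻¹]) (n : ℕ) :
    (trunc p).coeff n = p.coeff (n : ℤ) := by
  rfl

open LaurentPolynomial in
lemma toLaurent_coeff_nat {K : Type*} [Field K] (p : Polynomial K) (n : ℕ) :
    (Polynomial.toLaurent p).coeff (n : ℤ) = p.coeff n := by
  rw [← trunc_coeff', Polynomial.trunc_toLaurent]

open LaurentPolynomial in
lemma toLaurent_coeff_neg {K : Type*} [Field K] (p : Polynomial K) (k : ℤ) (hk : k < 0) :
    (Polynomial.toLaurent p).coeff k = 0 := by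
  by_contra h
  have := Finsupp.mem_support_iff.2 h
  rw [support_coeff_toLaurent] at this
  simp at this
  omega

open LaurentPolynomial in
lemma laurent_split {K : Type*} [Field K] (p : K[T;T⁻¹]) :
    p = Polynomial.toLaurent (trunc p) + 
      invert (Polynomial.toLaurent (trunc (invert p) - Polynomial.C (p.coeff 0))) := by
  ext k
  simp only [AddMonoidAlgebra.coeff_add, Finsupp.add_apply, invert_apply]
  rcases lt_trichotomy k 0 with hk | rfl | hk
  · obtain ⟨j, hj⟩ := Int.eq_ofNat_of_zero_le (show 0 ≤ -k by omega)
    rw [toLaurent_coeff_neg _ _ hk, hj, toLaurent_coeff_nat, Polynomial.coeff_sub, trunc_coeff',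
      Polynomial.coeff_C, if_neg (by omega), invert_apply, ← hj]
    simp
  · have := toLaurent_coeff_nat (trunc p) 0
    have h2 := toLaurent_coeff_nat (trunc (invert p) - Polynomial.C (p.coeff 0)) 0
    simp only [Nat.cast_zero, neg_zero] at *
    rw [this, h2, Polynomial.coeff_sub, trunc_coeff', trunc_coeff']
    simp
  · obtain ⟨j, hj⟩ := Int.eq_ofNat_of_zero_le (show 0 ≤ k by omega)
    rw [toLaurent_coeff_neg _ (-k) (by omega), hj, toLaurent_coeff_nat, trunc_coeff', add_zero]

/-- The step Laurent polynomial. -/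
noncomputable def stepP {K : Type*} [Field K] (S : Finset ℤ) (ω : ℤ → K) : LaurentPolynomial K :=
  ∑ s ∈ S, LaurentPolynomial.C (ω s) * LaurentPolynomial.T s

lemma stepP_mul_coeff {K : Type*} [Field K] (S : Finset ℤ) (ω : ℤ → K) (q : LaurentPolynomial K)
    (k : ℤ) : (stepP S ω * q).coeff k = ∑ s ∈ S, ω s * q.coeff (k - s) := by
  unfold stepP
  rw [Finset.sum_mul, AddMonoidAlgebra.coeff_sum, Finsupp.finsetSum_apply]
  refine Finset.sum_congr rfl fun s _ => ?_
  rw [← LaurentPolynomial.single_eq_C_mul_T, AddMonoidAlgebra.coeff_single_mul_apply]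
  congr 2
  ring

lemma stepP_invert {K : Type*} [Field K] (S : Finset ℤ) (ω : ℤ → K)
    (hsymS : ∀ s : ℤ, s ∈ S ↔ -s ∈ S) (hsymω : ∀ s ∈ S, ω s = ω (-s)) :
    LaurentPolynomial.invert (stepP S ω) = stepP S ω := by
  unfold stepP
  rw [map_sum]
  refine Finset.sum_nbij' (fun s => -s) (fun s => -s) (fun s hs => (hsymS s).1 hs)
    (fun s hs => (hsymS s).1 hs) (by simp) (by simp) ?_
  intro s hs
  rw [map_mul, LaurentPolynomial.invert_C, LaurentPolynomial.invert_T, hsymω s hs]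

/-- Polynomials of nonnegative walks. -/
noncomputable def Fs {K : Type*} [Field K] (P : LaurentPolynomial K) : ℕ → Polynomial K
  | 0 => 1
  | n + 1 => LaurentPolynomial.trunc (P * Polynomial.toLaurent (Fs P n))

/-- Reflected polynomials of walks that just became negative. -/
noncomputable def Hs {K : Type*} [Field K] (P : LaurentPolynomial K) : ℕ → Polynomial K
  | 0 => 0
  | n + 1 => LaurentPolynomial.trunc (LaurentPolynomial.invert
      (P * Polynomial.toLaurent (Fs P n))) -
      Polynomial.C ((P * Polynomial.toLaurent (Fs P n)).coeff 0)

lemma Fs_coeff {K : Type*} [Field K] (S : Finset ℤ) (ω : ℤ → K) (n : ℕ) : ∀ k : ℤ,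
    (Polynomial.toLaurent (Fs (stepP S ω) n)).coeff k = walkW S ω n k := by
  induction n with
  | zero =>
    intro k
    rw [walkW_zero]
    simp only [Fs, map_one, ← LaurentPolynomial.T_zero, LaurentPolynomial.T,
      AddMonoidAlgebra.coeff_single, Finsupp.single_apply, eq_comm]
  | succ n ih =>
    intro k
    rcases lt_or_ge k 0 with hk | hk
    · rw [walkW_neg _ _ _ _ hk, toLaurent_coeff_neg _ _ hk]
    · rw [walkW_succ _ _ _ _ hk]
      obtain ⟨j, rfl⟩ := Int.eq_ofNat_of_zero_le hk
      rw [toLaurent_coeff_nat, Fs, trunc_coeff', stepP_mul_coeff]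
      simp only [ih]

lemma Hs_coeff_zero {K : Type*} [Field K] (P : LaurentPolynomial K) (n : ℕ) :
    (Hs P n).coeff 0 = 0 := by
  cases n with
  | zero => simp [Hs]
  | succ n =>
    rw [Hs, Polynomial.coeff_sub, trunc_coeff', LaurentPolynomial.invert_apply]
    simp

lemma Hs_coeff_large {K : Type*} [Field K] (S : Finset ℤ) (ω : ℤ → K) (a : ℕ)
    (hmax : ∀ s ∈ S, -(a : ℤ) ≤ s ∧ s ≤ (a : ℤ)) (n j : ℕ) (hj : a < j) :
    (Hs (stepP S ω) n).coeff j = 0 := by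
  cases n with
  | zero => simp [Hs]
  | succ n =>
    rw [Hs, Polynomial.coeff_sub, trunc_coeff', LaurentPolynomial.invert_apply, Polynomial.coeff_C,
      if_neg (by omega), sub_zero, stepP_mul_coeff]
    refine Finset.sum_eq_zero fun s hs => ?_
    have := hmax s hs
    rw [toLaurent_coeff_neg _ _ (by omega), mul_zero]
open Polynomial in
lemma aux_roots {L : Type*} [Field L] (M : Multiset L) (h0 : (0:L) ∉ M) :
    ((M.map (fun u => X - C u)).prod * (M.map (fun u => 1 - C u * X)).prod).roots
      = M + M.map (fun u => u⁻¹) := by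
  have h1 : (M.map (fun u : L => (1 - C u * X : L[X]))).prod
      = C ((M.map (fun u : L => -u)).prod) * ((M.map (fun u => u⁻¹)).map (fun u => X - C u)).prod := by
    induction M using Multiset.induction_on with
    | empty => simp
    | cons u M ih =>
      simp only [Multiset.mem_cons, not_or] at h0
      have hu : u ≠ 0 := fun h => h0.1 h.symm
      simp only [Multiset.map_cons, Multiset.prod_cons, ih h0.2, C_mul]
      have : (1 - C u * X : L[X]) = C (-u) * (X - C u⁻¹) := by
        rw [mul_sub, ← C_mul]
        simp [hu]
        ring
      rw [this]; ring
  have h2 : (M.map (fun u : L => -u)).prod ≠ 0 := by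
    rw [Ne, Multiset.prod_eq_zero_iff]
    simpa using h0
  rw [h1, mul_left_comm, roots_C_mul _ h2, ← Multiset.prod_add, ← Multiset.map_add,
    roots_multiset_prod_X_sub_C]

lemma aux_multiset {L : Type*} [Field L] (M' : Multiset L) : ∀ (M : Multiset L)
    (_ : M + M.map (fun u => u⁻¹) = M' + M'.map (fun u => u⁻¹)),
    ∃ p ∈ M.antidiagonal, M'.prod = p.1.prod * p.2.prod⁻¹ := by
  induction M' using Multiset.induction_on with
  | empty =>
    intro M h
    have : M = 0 := by
      have := congrArg Multiset.card h
      simp at this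
      exact this
    subst this
    simp
  | cons x M' ih =>
    intro M h
    have hx : x ∈ M + M.map (fun u => u⁻¹) := by rw [h]; simp
    have key : x ∈ M ∨ x⁻¹ ∈ M := by
      rcases Multiset.mem_add.1 hx with h | h
      · exact Or.inl h
      · right
        obtain ⟨y, hy, rfl⟩ := Multiset.mem_map.1 h
        simpa using hy
    rcases key with h1 | h1
    · obtain ⟨M1, rfl⟩ := Multiset.exists_cons_of_mem h1
      obtain ⟨p, hp, hp2⟩ := ih M1 (by
        simp only [Multiset.map_cons, Multiset.cons_add, Multiset.add_cons] at h
        simpa using h)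
      refine ⟨(x ::ₘ p.1, p.2), ?_, ?_⟩
      · rw [Multiset.mem_antidiagonal] at hp ⊢
        simp [← hp]
      · simp [hp2, mul_assoc]
    · obtain ⟨M1, rfl⟩ := Multiset.exists_cons_of_mem h1
      obtain ⟨p, hp, hp2⟩ := ih M1 (by
        simp only [Multiset.map_cons, Multiset.cons_add, Multiset.add_cons, inv_inv] at h
        rw [Multiset.cons_swap] at h
        simpa using h)
      refine ⟨(p.1, x⁻¹ ::ₘ p.2), ?_, ?_⟩
      · rw [Multiset.mem_antidiagonal] at hp ⊢
        simp [← hp]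
      · simp [hp2, mul_comm, mul_left_comm]

open Polynomial in
lemma field_core {k L : Type*} [Field k] [CharZero k] [Field L] [IsAlgClosed L] [Algebra k L]
    (M : Multiset L) (h0 : (0:L) ∉ M) (Q : k[X]) (c : k) (hc : c ≠ 0)
    (h : (M.map (fun u => X - C u)).prod * (M.map (fun u => 1 - C u * X)).prod
      = C (algebraMap k L c * M.prod) * Q.map (algebraMap k L)) :
    IsIntegral k (algebraMap k L c * M.prod) ∧
      (minpoly k (algebraMap k L c * M.prod)).natDegree ≤ 2 ^ M.card := by
  have hcL : algebraMap k L c ≠ 0 := by simpa using hc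
  have hprod : M.prod ≠ 0 := by rwa [Ne, Multiset.prod_eq_zero_iff]
  have hroots : (Q.map (algebraMap k L)).roots = M + M.map (fun u => u⁻¹) := by
    rw [← aux_roots M h0, h, roots_C_mul _ (mul_ne_zero hcL hprod)]
  have hint : ∀ u ∈ M, IsIntegral k u := by
    intro u hu
    have : u ∈ (Q.map (algebraMap k L)).roots := by rw [hroots]; simp [hu]
    rw [mem_roots'] at this
    rw [← isAlgebraic_iff_isIntegral]
    refine ⟨Q, fun h => this.1 (by simp [h]), ?_⟩
    have := this.2
    rwa [IsRoot, eval_map_algebraMap] at this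
  have hMint : IsIntegral k M.prod := IsIntegral.multiset_prod hint
  set x := algebraMap k L c * M.prod with hx
  have hxint : IsIntegral k x := isIntegral_algebraMap.mul hMint
  refine ⟨hxint, ?_⟩
  let T : Finset L := (M.antidiagonal.map
    (fun p => algebraMap k L c * (p.1.prod * p.2.prod⁻¹))).toFinset
  have hT : T.card ≤ 2 ^ M.card := by
    refine (Multiset.toFinset_card_le _).trans ?_
    rw [Multiset.card_map, Multiset.card_antidiagonal]
  refine le_trans ?_ hT
  have hsep : (minpoly k x).Separable := (minpoly.irreducible hxint).separable
  have hcard := card_rootSet_eq_natDegree (K := L) hsep (IsAlgClosed.splits _)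
  rw [← hcard, ← Set.toFinset_card]
  apply Finset.card_le_card
  intro y hy
  rw [Set.mem_toFinset, mem_rootSet] at hy
  let S : Set L := {u | u ∈ M}
  have hMS : ∀ u ∈ M, u ∈ IntermediateField.adjoin k S :=
    fun u hu => IntermediateField.subset_adjoin k S hu
  have hxS : x ∈ IntermediateField.adjoin k S :=
    mul_mem (algebraMap_mem _ _) (multiset_prod_mem _ hMS)
  obtain ⟨φ, hφ⟩ := IntermediateField.exists_algHom_adjoin_of_splits_of_aeval (F := k) (S := S)
    (K := L) (x := x) (y := y) (fun s hs => ⟨hint s hs, IsAlgClosed.splits _⟩) hxS hy.2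
  obtain ⟨M1, hM1⟩ : ∃ M1 : Multiset (IntermediateField.adjoin k S),
      M1.map (algebraMap _ L) = M := by
    have : ∀ u ∈ M, u ∈ (IntermediateField.adjoin k S : Set L) := hMS
    lift M to Multiset (IntermediateField.adjoin k S : Set L) using this with M1
    exact ⟨M1, rfl⟩
  have h1 : (M1.map (fun u => X - C u)).prod * (M1.map (fun u => 1 - C u * X)).prod
      = C (algebraMap k _ c * M1.prod) * Q.map (algebraMap k (IntermediateField.adjoin k S)) := by
    apply Polynomial.map_injective (algebraMap (IntermediateField.adjoin k S) L)
      (algebraMap (IntermediateField.adjoin k S) L).injective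
    rw [hx, ← hM1] at h
    simpa [Polynomial.map_multiset_prod, Multiset.map_map, Function.comp_def, Polynomial.map_map,
      ← IsScalarTower.algebraMap_eq, map_multiset_prod, ← IsScalarTower.algebraMap_apply] using h
  let M2 := M1.map φ
  have h2 : (M2.map (fun u => X - C u)).prod * (M2.map (fun u => 1 - C u * X)).prod
      = C (algebraMap k _ c * M2.prod) * Q.map (algebraMap k L) := by
    have := congrArg (Polynomial.map (φ : _ →+* L)) h1
    simpa [M2, Polynomial.map_multiset_prod, Multiset.map_map, Function.comp_def,
      Polynomial.map_map, map_multiset_prod] using this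
  have h02 : (0:L) ∉ M2 := by
    intro hm
    obtain ⟨u, hu, hu0⟩ := Multiset.mem_map.1 hm
    have : u = 0 := by simpa using hu0
    apply h0
    rw [← hM1]
    exact Multiset.mem_map.2 ⟨u, hu, by simp [this]⟩
  have hprod2 : M2.prod ≠ 0 := by rwa [Ne, Multiset.prod_eq_zero_iff]
  have hroots2 : (Q.map (algebraMap k L)).roots = M2 + M2.map (fun u => u⁻¹) := by
    rw [← aux_roots M2 h02, h2, roots_C_mul _ (mul_ne_zero hcL hprod2)]
  obtain ⟨p, hp, hp2⟩ := aux_multiset M2 M (hroots.symm.trans hroots2)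
  have hy2 : y = algebraMap k L c * M2.prod := by
    rw [← hφ]
    have : (⟨x, hxS⟩ : IntermediateField.adjoin k S) = algebraMap k _ c * M1.prod := by
      apply (algebraMap (IntermediateField.adjoin k S) L).injective
      rw [map_mul, ← IsScalarTower.algebraMap_apply, map_multiset_prod, hM1]
      rfl
    rw [this, map_mul, AlgHom.commutes, map_multiset_prod]
  rw [Multiset.mem_toFinset, Multiset.mem_map]
  exact ⟨p, hp, by rw [hy2, hp2]⟩

open Polynomial in
lemma aux_reverse {L : Type*} [Field L] (M : Multiset L) :
    (M.map (fun u => X - C u)).prod.reverse = (M.map (fun u => 1 - C u * X)).prod := by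
  induction M using Multiset.induction_on with
  | empty => simpa using reverse_C (1 : L)
  | cons u M ih =>
    simp only [Multiset.map_cons, Multiset.prod_cons, reverse_mul_of_domain, ih]
    congr 1
    ext n
    rw [reverse, natDegree_X_sub_C, coeff_reflect]
    rcases n with _ | _ | n
    · rw [revAt_le (by omega)]; simp
    · rw [revAt_le (by omega)]; simp [coeff_one]
    · rw [revAt_eq_self_of_lt (by omega)]; simp [coeff_one, coeff_X]

open Polynomial in
lemma ps_core_aux {K L k : Type*} [Field K] [Field L] [IsAlgClosed L] [Field k] [CharZero k]
    [Algebra K[X] k] [IsFractionRing K[X] k] [Algebra k L]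
    (ψ : PowerSeries K →+* L) (hψ : Function.Injective ψ) (g : K[X] →+* L)
    (hgdef : g = ψ.comp Polynomial.coeToPowerSeries.ringHom)
    (hkL : ∀ p : K[X], algebraMap k L (algebraMap K[X] k p) = g p) (a : ℕ) (ha : 1 ≤ a) (E : PowerSeries K)
    (A : (PowerSeries K)[X]) (hA : A.Monic) (hdeg : A.natDegree = a) (Q : K[X])
    (hQ : Q.coeff 0 ≠ 0)
    (h : A * A.reflect a = C E * (X ^ a - C PowerSeries.X * Q.map PowerSeries.C)) :
    ∃ p : Polynomial (Polynomial K), p ≠ 0 ∧ p.natDegree ≤ 2 ^ a ∧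
      Polynomial.eval₂ Polynomial.coeToPowerSeries.ringHom E p = 0 := by
  have hg : Function.Injective g := by
    rw [hgdef]; exact hψ.comp (Polynomial.coe_injective K)
  -- the constant coefficient
  have hA0 : A.coeff 0 = - (PowerSeries.X * PowerSeries.C (Q.coeff 0)) * E := by
    have := congrArg (fun p => Polynomial.coeff p 0) h
    simp only [mul_coeff_zero, coeff_reflect, coeff_sub, coeff_C_zero, coeff_map, coeff_X_pow] at this
    rw [revAt_le (Nat.zero_le _), Nat.sub_zero, ← hdeg, hA.coeff_natDegree, hdeg,
      if_neg (by omega)] at this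
    rw [mul_one] at this
    rw [this]; ring
  have hE : E ≠ 0 := by
    intro hE
    rw [hE, C_0, zero_mul, mul_eq_zero] at h
    rcases h with h | h
    · exact hA.ne_zero h
    · rw [reflect_eq_zero_iff] at h
      exact hA.ne_zero h
  have hQ' : (PowerSeries.X * PowerSeries.C (Q.coeff 0) : PowerSeries K) ≠ 0 := by
    refine mul_ne_zero PowerSeries.X_ne_zero ?_
    rw [Ne, map_eq_zero_iff _ PowerSeries.C_injective]
    exact hQ
  have hA0' : A.coeff 0 ≠ 0 := by
    rw [hA0]; exact mul_ne_zero (neg_ne_zero.2 hQ') hE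
  set M := (A.map ψ).roots with hM
  have hMA : (M.map (fun u => X - C u)).prod = A.map ψ :=
    ((IsAlgClosed.splits (A.map ψ)).eq_prod_roots_of_monic (hA.map ψ)).symm
  have hcard : M.card = a := by
    have := (IsAlgClosed.splits (A.map ψ)).natDegree_eq_card_roots
    rw [hA.natDegree_map, hdeg] at this
    exact this.symm
  have hMrev : (M.map (fun u => 1 - C u * X)).prod = (A.reflect a).map ψ := by
    rw [← aux_reverse, hMA, reverse, hA.natDegree_map, hdeg, reflect_map]
  have hMprod : (-1) ^ a * M.prod = ψ (A.coeff 0) := by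
    have := congrArg (fun p => Polynomial.coeff p 0) hMA
    simp only [coeff_zero_multiset_prod, Multiset.map_map, Function.comp_def, coeff_sub,
      coeff_X_zero, coeff_C_zero, zero_sub, coeff_map] at this
    rw [← this, ← hcard, ← Multiset.prod_map_neg]
  have h0 : (0:L) ∉ M := by
    rw [← Multiset.prod_eq_zero_iff]
    intro hz
    rw [hz, mul_zero] at hMprod
    exact hA0' (hψ (by rw [← hMprod, map_zero]))
  let d : K[X] := X * C (Q.coeff 0)
  have hd : d ≠ 0 := mul_ne_zero X_ne_zero (by simpa using hQ)
  have hdk : algebraMap K[X] k d ≠ 0 := by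
    rw [Ne, map_eq_zero_iff _ (IsFractionRing.injective _ _)]; exact hd
  let c : k := - (-1) ^ a * (algebraMap K[X] k d)⁻¹
  have hc : c ≠ 0 := mul_ne_zero (by simp) (inv_ne_zero hdk)
  have hgd : g d = ψ (PowerSeries.X * PowerSeries.C (Q.coeff 0)) := by
    rw [hgdef, RingHom.comp_apply]
    congr 1
    simp only [d, map_mul, coeToPowerSeries.ringHom_apply, coe_X, coe_C]
  have hcE : algebraMap k L c * M.prod = ψ E := by
    have h1 : algebraMap k L c = - (-1) ^ a * (g d)⁻¹ := by
      simp only [c, neg_mul, map_mul, map_neg, map_pow, map_one, map_inv₀, hkL]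
    have hgd0 : g d ≠ 0 := by rw [Ne, map_eq_zero_iff _ hg]; exact hd
    rw [hA0, map_mul, map_neg, ← hgd] at hMprod
    have h2 : M.prod = (-1) ^ a * (- g d * ψ E) := by
      rw [← hMprod, ← mul_assoc, ← mul_pow]; simp
    have h3 : ((-1 : L) ^ a) * (-1) ^ a = 1 := by rw [← mul_pow]; simp
    rw [h1, h2]
    field_simp
    linear_combination (ψ E) * h3
  let Qk : k[X] := X ^ a - C (algebraMap K[X] k X) * Q.map ((algebraMap K[X] k).comp C)
  have hQk : Qk.map (algebraMap k L) =
      (X ^ a - C PowerSeries.X * Q.map PowerSeries.C : (PowerSeries K)[X]).map ψ := by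
    simp only [Qk, Polynomial.map_sub, Polynomial.map_mul, Polynomial.map_pow, map_X, map_C, hkL,
      Polynomial.map_map]
    congr 2
    · simp [hgdef]
    · congr 1
      ext x
      simp only [RingHom.comp_apply, hkL]
      simp [hgdef]
  obtain ⟨hint, hdeg2⟩ := field_core (k := k) M h0 Qk c hc (by
    rw [hMA, hMrev, hcE, hQk, ← Polynomial.map_mul, h, Polynomial.map_mul, map_C])
  rw [hcE, hcard] at *
  refine ⟨IsLocalization.integerNormalization (nonZeroDivisors K[X]) (minpoly k (ψ E)), ?_, ?_, ?_⟩
  · rw [Ne, IsLocalization.integerNormalization_eq_zero_iff le_rfl]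
    exact minpoly.ne_zero hint
  · refine le_trans ?_ hdeg2
    exact natDegree_le_natDegree (degree_mono (IsLocalization.integerNormalization_support _ _))
  · apply hψ
    rw [map_zero, Polynomial.hom_eval₂]
    have := IsLocalization.integerNormalization_eval₂_eq_zero (nonZeroDivisors K[X])
      (algebraMap k L) (minpoly k (ψ E)) (x := ψ E) (minpoly.aeval k (ψ E))
    have e : (algebraMap k L).comp (algebraMap K[X] k)
        = ψ.comp Polynomial.coeToPowerSeries.ringHom := by
      rw [← hgdef]
      exact RingHom.ext fun p => hkL p
    rw [e] at this
    exact this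

open Polynomial in
lemma ps_core {K : Type*} [Field K] [CharZero K] (a : ℕ) (ha : 1 ≤ a) (E : PowerSeries K)
    (A : (PowerSeries K)[X]) (hA : A.Monic) (hdeg : A.natDegree = a) (Q : K[X])
    (hQ : Q.coeff 0 ≠ 0)
    (h : A * A.reflect a = C E * (X ^ a - C PowerSeries.X * Q.map PowerSeries.C)) :
    ∃ p : Polynomial (Polynomial K), p ≠ 0 ∧ p.natDegree ≤ 2 ^ a ∧
      Polynomial.eval₂ Polynomial.coeToPowerSeries.ringHom E p = 0 := by
  let L := AlgebraicClosure (FractionRing (PowerSeries K))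
  let ψ : PowerSeries K →+* L :=
    (algebraMap (FractionRing (PowerSeries K)) L).comp (algebraMap _ _)
  have hψ : Function.Injective ψ :=
    (algebraMap (FractionRing (PowerSeries K)) L).injective.comp (IsFractionRing.injective _ _)
  let k := FractionRing K[X]
  let g : K[X] →+* L := ψ.comp Polynomial.coeToPowerSeries.ringHom
  have hg : Function.Injective g := hψ.comp (Polynomial.coe_injective K)
  let _ : Algebra k L := (IsFractionRing.lift (K := k) hg).toAlgebra
  have hkL : ∀ p : K[X], algebraMap k L (algebraMap K[X] k p) = g p := fun p =>
    IsFractionRing.lift_algebraMap hg p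
  have : CharZero k := charZero_of_injective_algebraMap (R := K[X]) (IsFractionRing.injective _ _)
  exact ps_core_aux (k := k) ψ hψ g rfl hkL a ha E A hA hdeg Q hQ h

section Kernel

variable {K : Type*} [Field K]

/-- Coefficientwise embedding of polynomials into Laurent polynomials. -/
noncomputable def psI : PowerSeries (Polynomial K) →+* PowerSeries (LaurentPolynomial K) :=
  PowerSeries.map Polynomial.toLaurent

/-- Coefficientwise inversion. -/
noncomputable def psJ : PowerSeries (LaurentPolynomial K) →+* PowerSeries (LaurentPolynomial K) :=
  PowerSeries.map (LaurentPolynomial.invert : LaurentPolynomial K ≃ₐ[K] LaurentPolynomial K).toRingHom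

lemma coeff_psI (n : ℕ) (p : PowerSeries (Polynomial K)) :
    PowerSeries.coeff n (psI p) = Polynomial.toLaurent (PowerSeries.coeff n p) := by
  simp [psI]

lemma coeff_psJ (n : ℕ) (p : PowerSeries (LaurentPolynomial K)) :
    PowerSeries.coeff n (psJ p) = LaurentPolynomial.invert (PowerSeries.coeff n p) := by
  simp [psJ]

lemma psJ_psJ (p : PowerSeries (LaurentPolynomial K)) : psJ (psJ p) = p := by
  ext1 n
  rw [coeff_psJ, coeff_psJ]
  exact LaurentPolynomial.involutive_invert _

lemma psI_injective : Function.Injective (psI (K := K)) := by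
  intro p q h
  ext1 n
  apply Polynomial.toLaurent_injective
  rw [← coeff_psI, ← coeff_psI, h]

lemma kernel_eq (P : LaurentPolynomial K) :
    psI (PowerSeries.mk (Fs P)) * (1 - PowerSeries.X * PowerSeries.C P)
      = 1 - psJ (psI (PowerSeries.mk (Hs P))) := by
  ext1 n
  rw [mul_sub, mul_one, map_sub, map_sub, mul_left_comm, coeff_psJ, coeff_psI, coeff_psI]
  cases n with
  | zero => simp [Fs, Hs]
  | succ n =>
    rw [PowerSeries.coeff_succ_X_mul, PowerSeries.coeff_mul_C, coeff_psI]
    simp only [PowerSeries.coeff_mk]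
    rw [PowerSeries.coeff_one, if_neg (by omega), mul_comm]
    conv_lhs => rw [laurent_split (P * _)]
    rw [Fs, Hs]
    ring

lemma kernel_eq_inv (P : LaurentPolynomial K) (hP : LaurentPolynomial.invert P = P) :
    psJ (psI (PowerSeries.mk (Fs P))) * (1 - PowerSeries.X * PowerSeries.C P)
      = 1 - psI (PowerSeries.mk (Hs P)) := by
  have h := congrArg psJ (kernel_eq P)
  rw [map_mul, map_sub, map_sub, map_one, psJ_psJ, map_mul] at h
  have h1 : psJ (PowerSeries.X : PowerSeries (LaurentPolynomial K)) = PowerSeries.X := by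
    simp [psJ]
  have h2 : psJ (PowerSeries.C P) = PowerSeries.C P := by
    simp [psJ, hP]
  rwa [h1, h2] at h

lemma const_of_inv (p : Polynomial K)
    (h : Polynomial.toLaurent p = LaurentPolynomial.invert (Polynomial.toLaurent p)) :
    p = Polynomial.C (p.coeff 0) := by
  ext j
  rw [Polynomial.coeff_C]
  split_ifs with hj
  · rw [hj]
  · rw [← toLaurent_coeff_nat, h, LaurentPolynomial.invert_apply, toLaurent_coeff_neg _ _ (by omega)]

lemma wiener_hopf (P : LaurentPolynomial K) (hP : LaurentPolynomial.invert P = P) :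
    (1 - psI (PowerSeries.mk (Hs P))) * psJ (1 - psI (PowerSeries.mk (Hs P))) =
      PowerSeries.map LaurentPolynomial.C (PowerSeries.mk fun n => (Fs P n).coeff 0)
        * (1 - PowerSeries.X * PowerSeries.C P) := by
  have h1 := kernel_eq P
  have h2 := kernel_eq_inv P hP
  set F := PowerSeries.mk (Fs P) with hF
  set H := PowerSeries.mk (Hs P) with hH
  have h3 : psI ((1 - H) * F) = psJ (psI ((1 - H) * F)) := by
    rw [map_mul, map_mul, map_sub, map_sub, map_one, map_one, ← h1, ← h2]
    ring
  have h4 : (1 - H) * F = PowerSeries.map Polynomial.C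
      (PowerSeries.map Polynomial.constantCoeff ((1 - H) * F)) := by
    ext1 n
    rw [PowerSeries.coeff_map, PowerSeries.coeff_map]
    refine const_of_inv _ ?_
    rw [← coeff_psI, ← coeff_psJ, ← h3]
  have h5 : PowerSeries.map Polynomial.constantCoeff ((1 - H) * F)
      = PowerSeries.mk fun n => (Fs P n).coeff 0 := by
    have : PowerSeries.map Polynomial.constantCoeff H = 0 := by
      ext n
      simp [hH, Hs_coeff_zero]
    rw [map_mul, map_sub, map_one, this, sub_zero, one_mul]
    ext n
    simp [hF]
  rw [h5] at h4
  have h6 : psI ((1 - H) * F) = PowerSeries.map LaurentPolynomial.C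
      (PowerSeries.mk fun n => (Fs P n).coeff 0) := by
    rw [h4]
    ext1 n
    simp [psI]
  rw [← h6, map_mul, map_sub, map_sub, map_one, map_one, ← h1]
  ring

/-- Swap of the two variables. -/
noncomputable def swapHom : Polynomial (PowerSeries K) →+* PowerSeries (Polynomial K) :=
  Polynomial.eval₂RingHom (PowerSeries.map Polynomial.C) (PowerSeries.C Polynomial.X)

lemma swapHom_coeff (p : Polynomial (PowerSeries K)) (n j : ℕ) :
    (PowerSeries.coeff n (swapHom p)).coeff j = PowerSeries.coeff n (p.coeff j) := by
  induction p using Polynomial.induction_on' with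
  | add p q hp hq => simp [hp, hq]
  | monomial i r =>
    rw [swapHom, Polynomial.coe_eval₂RingHom, Polynomial.eval₂_monomial, ← map_pow,
      PowerSeries.coeff_mul_C, PowerSeries.coeff_map, Polynomial.coeff_C_mul_X_pow,
      Polynomial.coeff_monomial]
    by_cases h : j = i
    · simp [h]
    · simp [h, Ne.symm h]

lemma swapHom_injective : Function.Injective (swapHom (K := K)) := by
  intro p q h
  ext j n
  rw [← swapHom_coeff, h, swapHom_coeff]

lemma swapHom_reflect (a : ℕ) (p : Polynomial (PowerSeries K)) (hp : p.natDegree ≤ a) :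
    psI (swapHom (p.reflect a)) =
      PowerSeries.C (LaurentPolynomial.T a) * psJ (psI (swapHom p)) := by
  refine Polynomial.induction_with_natDegree_le
    (fun p => psI (swapHom (p.reflect a)) =
      PowerSeries.C (LaurentPolynomial.T a) * psJ (psI (swapHom p))) a ?_ ?_ ?_ p hp
  · simp
  · intro n r _ hn
    rw [Polynomial.reflect_C_mul_X_pow, Polynomial.revAt_le hn]
    have hr : psJ (psI (swapHom (Polynomial.C r))) = psI (swapHom (Polynomial.C r)) := by
      ext1 m
      simp [psI, psJ, swapHom]
    have hX : ∀ i : ℕ, psI (swapHom ((Polynomial.X : Polynomial (PowerSeries K)) ^ i)) =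
        PowerSeries.C (LaurentPolynomial.T i) := by
      intro i
      simp [psI, swapHom, ← map_pow, LaurentPolynomial.T_pow]
    have hXJ : psJ (PowerSeries.C (LaurentPolynomial.T n) : PowerSeries (LaurentPolynomial K))
        = PowerSeries.C (LaurentPolynomial.T (-n)) := by
      simp [psJ]
    rw [map_mul, map_mul, map_mul, map_mul, map_mul, hr, hX, hX, hXJ, mul_left_comm, ← map_mul,
      ← LaurentPolynomial.T_add]
    congr 3
    omega
  · intro f g _ _ hf hg
    rw [Polynomial.reflect_add, map_add, map_add, hf, hg, map_add, map_add, map_add, mul_add]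

end Kernel

/-- For a symmetric step set `S = -S` with symmetric weights `ω_s = ω_{-s}` and
`a = max S`, the excursion generating function `E` is algebraic over `K(t)` of
degree at most `2^a`: there is a nonzero polynomial in `z` of degree at most `2^a`
with coefficients in `K[t]` that vanishes at `z = E`. -/
theorem symmetric_excursion_degree {K : Type*} [Field K] [CharZero K]
    (S : Finset ℤ) (ω : ℤ → K) (a : ℕ) (ha : 1 ≤ a)
    (haS : (a : ℤ) ∈ S) (hmax : ∀ s ∈ S, -(a : ℤ) ≤ s ∧ s ≤ (a : ℤ))
    (hsymS : ∀ s : ℤ, s ∈ S ↔ -s ∈ S) (hsymω : ∀ s ∈ S, ω s = ω (-s))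
    (hωa : ω a ≠ 0) :
    ∃ p : Polynomial (Polynomial K), p ≠ 0 ∧ p.natDegree ≤ 2 ^ a ∧
      Polynomial.eval₂ Polynomial.coeToPowerSeries.ringHom (excursionGFW S ω) p = 0 := by
  have hE : excursionGFW S ω = PowerSeries.mk fun n => (Fs (stepP S ω) n).coeff 0 := by
    ext n
    rw [excursionGFW, PowerSeries.coeff_mk, PowerSeries.coeff_mk, ← toLaurent_coeff_nat, Fs_coeff]
    rfl
  set E := excursionGFW S ω with hEdef
  have hWH := wiener_hopf (stepP S ω) (stepP_invert S ω hsymS hsymω)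
  rw [← hE] at hWH
  set H := PowerSeries.mk (Hs (stepP S ω)) with hH
  let N : Polynomial (PowerSeries K) := ∑ j ∈ Finset.range (a + 1),
    Polynomial.monomial j (PowerSeries.mk fun n => (PowerSeries.coeff n (1 - H)).coeff j)
  have hNcoeff : ∀ j, j ≤ a →
      N.coeff j = PowerSeries.mk fun n => (PowerSeries.coeff n (1 - H)).coeff j := by
    intro j hj
    simp only [N, Polynomial.finsetSum_coeff, Polynomial.coeff_monomial]
    rw [Finset.sum_ite_eq' , if_pos (by simp; omega)]
  have hNdeg : N.natDegree ≤ a := by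
    refine Polynomial.natDegree_sum_le_of_forall_le _ _ fun j hj => ?_
    refine (Polynomial.natDegree_monomial_le _).trans ?_
    simp at hj; omega
  have hN : swapHom N = 1 - H := by
    ext n j
    rw [swapHom_coeff]
    rcases Nat.lt_or_ge a j with hj | hj
    · rw [Polynomial.coeff_eq_zero_of_natDegree_lt (by omega), map_sub, Polynomial.coeff_sub, hH,
        PowerSeries.coeff_mk, Hs_coeff_large S ω a hmax n j hj, PowerSeries.coeff_one]
      have : j ≠ 0 := by omega
      split_ifs <;> simp [Polynomial.coeff_one, this]
    · rw [hNcoeff j hj, PowerSeries.coeff_mk]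
  have hN0 : N.coeff 0 = 1 := by
    rw [hNcoeff 0 (Nat.zero_le _)]
    ext n
    rw [PowerSeries.coeff_mk, map_sub, Polynomial.coeff_sub, hH, PowerSeries.coeff_mk,
      Hs_coeff_zero, PowerSeries.coeff_one, PowerSeries.coeff_one]
    split_ifs <;> simp
  have hRdeg : (N.reflect a).natDegree ≤ a := by
    rw [Polynomial.natDegree_le_iff_coeff_eq_zero]
    intro m hm
    rw [Polynomial.coeff_reflect, Polynomial.revAt_eq_self_of_lt hm]
    exact Polynomial.coeff_eq_zero_of_natDegree_lt (by omega)
  have hRa : (N.reflect a).coeff a = 1 := by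
    rw [Polynomial.coeff_reflect, Polynomial.revAt_le le_rfl, Nat.sub_self, hN0]
  have hRmonic : (N.reflect a).Monic := Polynomial.monic_of_natDegree_le_of_coeff_eq_one a hRdeg hRa
  have hRdeg' : (N.reflect a).natDegree = a :=
    le_antisymm hRdeg (Polynomial.le_natDegree_of_ne_zero (by rw [hRa]; exact one_ne_zero))
  have hRR : (N.reflect a).reflect a = N := by
    ext1 j
    rw [Polynomial.coeff_reflect, Polynomial.coeff_reflect, Polynomial.revAt_invol]
  let Q : Polynomial K := ∑ s ∈ S, Polynomial.C (ω s) * Polynomial.X ^ (s + a).toNat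
  have hQ0 : Q.coeff 0 = ω (-a) := by
    simp only [Q, Polynomial.finsetSum_coeff, Polynomial.coeff_C_mul_X_pow]
    rw [Finset.sum_eq_single (-(a:ℤ))]
    · simp
    · intro s hs hne
      have := hmax s hs
      rw [if_neg (by omega)]
    · intro h
      exact absurd ((hsymS _).1 haS) h
  have hQL : Polynomial.toLaurent Q = LaurentPolynomial.T a * stepP S ω := by
    simp only [Q, stepP, map_sum, Finset.mul_sum]
    refine Finset.sum_congr rfl fun s hs => ?_
    have := hmax s hs
    rw [Polynomial.toLaurent_C_mul_X_pow, mul_left_comm, ← LaurentPolynomial.T_add]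
    congr 2
    omega
  refine ps_core a ha E (N.reflect a) hRmonic hRdeg' Q
    (by rw [hQ0, ← hsymω _ haS]; exact hωa) ?_
  rw [hRR]
  apply swapHom_injective
  apply psI_injective
  rw [map_mul, map_mul, swapHom_reflect a N hNdeg, hN]
  have e1 : psI (1 - H) = 1 - psI H := by rw [map_sub, map_one]
  rw [e1, mul_assoc, mul_comm (psJ _), hWH]
  have e2 : psI (swapHom (Polynomial.C E)) = PowerSeries.map LaurentPolynomial.C E := by
    ext1 n
    simp [psI, swapHom]
  have e3 : psI (swapHom (Polynomial.X ^ a)) =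
      (PowerSeries.C (LaurentPolynomial.T a) : PowerSeries (LaurentPolynomial K)) := by
    simp [psI, swapHom, ← map_pow, LaurentPolynomial.T_pow]
  have e4 : psI (swapHom (Polynomial.C PowerSeries.X)) =
      (PowerSeries.X : PowerSeries (LaurentPolynomial K)) := by
    simp [psI, swapHom]
  have e5 : psI (swapHom (Q.map PowerSeries.C)) =
      PowerSeries.C (LaurentPolynomial.T a * stepP S ω) := by
    rw [← hQL]
    have : swapHom (Q.map PowerSeries.C) = PowerSeries.C Q := by
      ext n j
      rw [swapHom_coeff, Polynomial.coeff_map, PowerSeries.coeff_C, PowerSeries.coeff_C]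
      split_ifs <;> simp
    rw [this]
    simp [psI]
  rw [map_mul, map_mul, map_sub, map_sub, map_mul, map_mul, e2, e3, e4, e5, map_mul]
  ring
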